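/- Let Σ, G ∈ ℝ^{ℓn×ℓ}, and let P = Pᵀ ∈ ℝ^{ℓn×ℓn} be positive definite with HPHᵀ < I_ℓ (i.e. I_ℓ − HPHᵀ positive definite), and suppose that, with Γ := J − ΣH, the equation P = Γ(P − PHᵀHP)Γᵀ + GGᵀ holds. Set A := ΓPHᵀ + Σ − G and B := ΓPHᵀ + Σ + G. Then, in the ℓ×ℓ matrices over the field ℝ(z) of real rational functions, A(z)·B(z⁻¹)ᵀ + B(z)·A(z⁻¹)ᵀ = 2·Σ(z)·(I_ℓ − HPHᵀ)·Σ(z⁻¹)ᵀ, where for X ∈ ℝ^{ℓn×ℓ}, X(z) := zⁿI_ℓ + Π(z)X and X(z⁻¹) is obtained by substituting z⁻¹ for z in every entry. -/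

import Mathlib

open Matrix

set_option synthInstance.maxHeartbeats 1000000
set_option maxHeartbeats 1000000

noncomputable section

/-- `H = I_ℓ ⊗ h_n` with `h_n = (1,0,…,0)`. -/
def Hmat (ℓ n : ℕ) : Matrix (Fin ℓ) (Fin ℓ × Fin n) ℝ :=
  Matrix.of fun a y => if a = y.1 ∧ (y.2 : ℕ) = 0 then 1 else 0

/-- `J = I_ℓ ⊗ J_n` with `J_n` the `n×n` shift matrix (ones on the superdiagonal). -/
def Jmat (ℓ n : ℕ) : Matrix (Fin ℓ × Fin n) (Fin ℓ × Fin n) ℝ :=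
  Matrix.of fun x y => if x.1 = y.1 ∧ (x.2 : ℕ) + 1 = (y.2 : ℕ) then 1 else 0

/-- `Π(w) = I_ℓ ⊗ (w^{n−1},…,w,1)` evaluated at `w ∈ ℝ(z)`. -/
def PiMat (ℓ n : ℕ) (w : RatFunc ℝ) : Matrix (Fin ℓ) (Fin ℓ × Fin n) (RatFunc ℝ) :=
  Matrix.of fun a y => if a = y.1 then w ^ (n - 1 - (y.2 : ℕ)) else 0

/-- For `X ∈ ℝ^{ℓn×ℓ}`, the matrix polynomial `X(w) := wⁿ I_ℓ + Π(w)X`, evaluated at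
`w ∈ ℝ(z)` (so `X(z⁻¹)` is obtained by substituting `z⁻¹` for `z` in every entry). -/
def matPoly (ℓ n : ℕ) (X : Matrix (Fin ℓ × Fin n) (Fin ℓ) ℝ) (w : RatFunc ℝ) :
    Matrix (Fin ℓ) (Fin ℓ) (RatFunc ℝ) :=
  w ^ n • (1 : Matrix (Fin ℓ) (Fin ℓ) (RatFunc ℝ)) +
    PiMat ℓ n w * X.map (fun r => RatFunc.C r)

/-- Multiplying by the shift matrix: `Π(w) J = w Π(w) - wⁿ H`. -/
theorem PiMat_mul_Jmat (ℓ n : ℕ) (w : RatFunc ℝ) :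
    PiMat ℓ n w * (Jmat ℓ n).map RatFunc.C =
      w • PiMat ℓ n w - w ^ n • (Hmat ℓ n).map RatFunc.C := by
  ext a ⟨b, j⟩
  simp only [Matrix.mul_apply, PiMat, Jmat, Hmat, Matrix.of_apply, Matrix.map_apply,
    Matrix.sub_apply, Matrix.smul_apply, smul_eq_mul, Fintype.sum_prod_type]
  rw [Finset.sum_eq_single a (fun c _ hc => by simp [hc.symm]) (by simp)]
  by_cases hab : a = b
  · subst hab
    have hj := j.isLt
    rcases Nat.eq_zero_or_pos (j : ℕ) with h0 | hpos
    · have hw : w * w ^ (n - 1) = w ^ n := by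
        rw [← pow_succ']
        congr 1
        omega
      simp [h0, hw]
    · have hlt : (j : ℕ) - 1 < n := by omega
      rw [Finset.sum_eq_single (⟨(j : ℕ) - 1, hlt⟩ : Fin n)]
      · have hw : w ^ (n - 1 - ((j : ℕ) - 1)) = w * w ^ (n - 1 - (j : ℕ)) := by
          rw [← pow_succ']
          congr 1
          omega
        have h1 : (j : ℕ) - 1 + 1 = j := by omega
        simp [h1, hpos.ne', hw]
      · intro k _ hk
        have hne : ¬ ((k : ℕ) + 1 = j) := fun h => hk (Fin.ext (by simp; omega))
        simp [hne]
      · simp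
  · simp [hab]

/-- `Π(w) (J - Σ H) = w Π(w) - Σ(w) H`, written without subtraction. -/
theorem smul_PiMat_eq (ℓ n : ℕ) (S : Matrix (Fin ℓ × Fin n) (Fin ℓ) ℝ) (w : RatFunc ℝ) :
    w • PiMat ℓ n w =
      PiMat ℓ n w * (Jmat ℓ n - S * Hmat ℓ n).map RatFunc.C +
        matPoly ℓ n S w * (Hmat ℓ n).map RatFunc.C := by
  rw [Matrix.map_sub _ (map_sub _), Matrix.map_mul, Matrix.mul_sub, PiMat_mul_Jmat]
  simp only [matPoly, Matrix.add_mul, Matrix.smul_mul, Matrix.one_mul, Matrix.mul_assoc]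
  abel

/-- The algebraic core of the spectral factorization: `p`, `p'` stand for `Π(z)`, `Π(z⁻¹)ᵀ`
and `S`, `S'` for `Σ(z)`, `Σ(z⁻¹)ᵀ`. -/
theorem spectral_factorization_aux {K m k : Type*} [Field K] [Fintype m] [Fintype k]
    [DecidableEq m] {z : K} (hz : z ≠ 0)
    {p H : Matrix m k K} {p' H' G : Matrix k m K} {G' : Matrix m k K} {S S' : Matrix m m K}
    {P Γ Γ' : Matrix k k K}
    (hp : z • p = p * Γ + S * H) (hp' : z⁻¹ • p' = Γ' * p' + H' * S')
    (hric : P = Γ * (P - P * H' * H * P) * Γ' + G * G') :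
    (S + p * (Γ * P * H' - G)) * (S' + (H * P * Γ' + G') * p') +
        (S + p * (Γ * P * H' + G)) * (S' + (H * P * Γ' - G') * p') =
      (2 : K) • (S * (1 - H * P * H') * S') := by
  have hpP : p * P * p' = (p * Γ + S * H) * P * (Γ' * p' + H' * S') := by
    rw [← hp, ← hp']
    simp [smul_smul, hz]
  have hG : p * (G * G') * p' =
      p * P * p' - p * (Γ * (P - P * H' * H * P) * Γ') * p' := by
    conv_rhs => enter [1]; rw [hric]
    simp only [Matrix.mul_add, Matrix.add_mul]
    abel
  rw [hpP] at hG
  simp only [Matrix.mul_add, Matrix.add_mul, Matrix.mul_sub, Matrix.sub_mul, Matrix.mul_assoc,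
    Matrix.mul_one, two_smul] at hG ⊢
  rw [hG]
  abel

/-- If `P ≻ 0` is symmetric with `HPHᵀ < I`, and
`P = Γ(P − PHᵀHP)Γᵀ + GGᵀ` with `Γ := J − ΣH`, then with `A := ΓPHᵀ + Σ − G` and
`B := ΓPHᵀ + Σ + G` one has
`A(z)B(z⁻¹)ᵀ + B(z)A(z⁻¹)ᵀ = 2·Σ(z)(I − HPHᵀ)Σ(z⁻¹)ᵀ` over `ℝ(z)`. -/
theorem stmt12 (ℓ n : ℕ) (hℓ : 1 ≤ ℓ) (hn : 1 ≤ n)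
    (Sm G : Matrix (Fin ℓ × Fin n) (Fin ℓ) ℝ)
    (P : Matrix (Fin ℓ × Fin n) (Fin ℓ × Fin n) ℝ)
    (hPsym : Pᵀ = P) (hPpos : P.PosDef)
    (hR : ((1 : Matrix (Fin ℓ) (Fin ℓ) ℝ) - Hmat ℓ n * P * (Hmat ℓ n)ᵀ).PosDef)
    (Γ : Matrix (Fin ℓ × Fin n) (Fin ℓ × Fin n) ℝ) (hΓ : Γ = Jmat ℓ n - Sm * Hmat ℓ n)
    (hric : P = Γ * (P - P * (Hmat ℓ n)ᵀ * Hmat ℓ n * P) * Γᵀ + G * Gᵀ)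
    (A B : Matrix (Fin ℓ × Fin n) (Fin ℓ) ℝ)
    (hA : A = Γ * P * (Hmat ℓ n)ᵀ + Sm - G)
    (hB : B = Γ * P * (Hmat ℓ n)ᵀ + Sm + G) :
    matPoly ℓ n A RatFunc.X * (matPoly ℓ n B (RatFunc.X)⁻¹)ᵀ +
        matPoly ℓ n B RatFunc.X * (matPoly ℓ n A (RatFunc.X)⁻¹)ᵀ =
      (2 : RatFunc ℝ) •
        (matPoly ℓ n Sm RatFunc.X *
          ((1 : Matrix (Fin ℓ) (Fin ℓ) ℝ) - Hmat ℓ n * P * (Hmat ℓ n)ᵀ).map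
            (fun r => RatFunc.C r) *
          (matPoly ℓ n Sm (RatFunc.X)⁻¹)ᵀ) := by
  have key := spectral_factorization_aux (z := (RatFunc.X : RatFunc ℝ)) RatFunc.X_ne_zero
    (p := PiMat ℓ n RatFunc.X) (p' := (PiMat ℓ n (RatFunc.X)⁻¹)ᵀ)
    (H := (Hmat ℓ n).map RatFunc.C) (H' := (Hmat ℓ n)ᵀ.map RatFunc.C)
    (G := G.map RatFunc.C) (G' := Gᵀ.map RatFunc.C)
    (S := matPoly ℓ n Sm RatFunc.X) (S' := (matPoly ℓ n Sm (RatFunc.X)⁻¹)ᵀ)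
    (P := P.map RatFunc.C) (Γ := Γ.map RatFunc.C) (Γ' := Γᵀ.map RatFunc.C)
    (by rw [hΓ]; exact smul_PiMat_eq ℓ n Sm _)
    (by
      have h := congrArg Matrix.transpose (smul_PiMat_eq ℓ n Sm (RatFunc.X)⁻¹)
      rw [← hΓ] at h
      simpa only [Matrix.transpose_smul, Matrix.transpose_add, Matrix.transpose_mul,
        Matrix.transpose_map] using h)
    (by
      have h := congrArg (fun M => M.map (RatFunc.C : ℝ →+* RatFunc ℝ)) hric
      simpa only [Matrix.map_mul, Matrix.map_add _ (map_add (RatFunc.C : ℝ →+* RatFunc ℝ)),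
        Matrix.map_sub _ (map_sub (RatFunc.C : ℝ →+* RatFunc ℝ))] using h)
  have hPt : (P.map (RatFunc.C : ℝ →+* RatFunc ℝ))ᵀ = P.map RatFunc.C := by
    rw [← Matrix.transpose_map, hPsym]
  have hone : (1 : Matrix (Fin ℓ) (Fin ℓ) ℝ).map (RatFunc.C : ℝ →+* RatFunc ℝ) = 1 :=
    Matrix.map_one _ (map_zero _) (map_one _)
  subst hA hB
  convert key using 1
  · simp only [matPoly, Matrix.map_mul, Matrix.map_add _ (map_add (RatFunc.C : ℝ →+* RatFunc ℝ)),
      Matrix.map_sub _ (map_sub (RatFunc.C : ℝ →+* RatFunc ℝ)), Matrix.transpose_add,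
      Matrix.transpose_mul, Matrix.transpose_sub, Matrix.transpose_map, hPt,
      Matrix.transpose_transpose, Matrix.mul_add, Matrix.mul_sub,
      Matrix.add_mul, Matrix.sub_mul, Matrix.mul_assoc]
    abel
  · simp only [Matrix.map_mul, Matrix.map_sub _ (map_sub (RatFunc.C : ℝ →+* RatFunc ℝ)), hone]
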